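/- Let f be Hardy class from below of order 2 and suppose the restriction of f to the real axis is a Schwartz function. Then for every natural number n, sup_{y<0} ∫_ℝ |x+iy|^n |f(x+iy)|² dx < ∞; equivalently, multiplication by any branch of z^{n/2} analytic on the open lower half-plane maps f into a function again satisfying the Hardy class bound of order 2. (This is the analytic content of the statement that multiplication by s^{n/2} is a continuous linear operator on the Schwartz–Hardy space.) -/

import Mathlib

open MeasureTheory Filter

/-- `f : ℂ → ℂ` is Hardy class from below of order `p`: analytic on the open lower
half-plane, continuous on the closed lower half-plane, and the `L^p` norms of the
horizontal sections `x ↦ f (x + iy)`, `y < 0`, are uniformly bounded. -/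
def HardyBelow (p : ℝ) (f : ℂ → ℂ) : Prop :=
  DifferentiableOn ℂ f {z : ℂ | z.im < 0} ∧
  ContinuousOn f {z : ℂ | z.im ≤ 0} ∧
  ∃ M : ℝ, ∀ y : ℝ, y < 0 →
    Integrable (fun x : ℝ => ‖f (↑x + ↑y * Complex.I)‖ ^ p) ∧
    ∫ x : ℝ, ‖f (↑x + ↑y * Complex.I)‖ ^ p ≤ M

theorem differentiableOn_intervalIntegral_comp_add {F : ℂ → ℂ}
    (hF : DifferentiableOn ℂ F {z : ℂ | z.im < 0}) {h : ℝ → ℂ} (hh : Continuous h) (a b : ℝ) :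
    DifferentiableOn ℂ (fun z => ∫ t in a..b, F (z + t) * h t) {z : ℂ | z.im < 0} := by
  have hopen : IsOpen {z : ℂ | z.im < 0} := isOpen_lt Complex.continuous_im continuous_const
  have hF' : ContinuousOn (deriv F) {z : ℂ | z.im < 0} := (hF.deriv hopen).continuousOn
  have hsection : ∀ {g : ℂ → ℂ}, ContinuousOn g {z : ℂ | z.im < 0} → ∀ z : ℂ, z.im < 0 →
      Continuous fun t : ℝ => g (z + t) * h t := fun hg z hz =>
    (hg.comp_continuous (by fun_prop) fun t => by simpa using hz).mul hh
  intro z₀ hz₀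
  obtain ⟨r, hr, hball⟩ := Metric.nhds_basis_closedBall.mem_iff.mp (hopen.mem_nhds hz₀)
  have hK : IsCompact (Metric.closedBall z₀ r ×ˢ Set.uIcc a b) :=
    (isCompact_closedBall z₀ r).prod isCompact_uIcc
  have hcont : ContinuousOn (fun p : ℂ × ℝ => deriv F (p.1 + p.2) * h p.2)
      (Metric.closedBall z₀ r ×ˢ Set.uIcc a b) := by
    refine ContinuousOn.mul (hF'.comp (by fun_prop) fun p hp => ?_) (by fun_prop)
    simpa using hball hp.1
  obtain ⟨B, hB⟩ := hK.exists_bound_of_continuousOn hcont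
  refine ((intervalIntegral.hasDerivAt_integral_of_dominated_loc_of_deriv_le
    (F := fun z (t : ℝ) => F (z + t) * h t) (F' := fun z (t : ℝ) => deriv F (z + t) * h t)
    (bound := fun _ => B) (μ := volume)
    (Metric.closedBall_mem_nhds z₀ hr) ?_ ?_ ?_ ?_ ?_ ?_).2.differentiableAt).differentiableWithinAt
  · filter_upwards [hopen.mem_nhds hz₀] with z hz
    exact (hsection hF.continuousOn z hz).aestronglyMeasurable
  · exact (hsection hF.continuousOn z₀ hz₀).intervalIntegrable _ _
  · exact (hsection hF' z₀ hz₀).aestronglyMeasurable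
  · exact .of_forall fun t ht z hz => hB (z, t) ⟨hz, Set.uIoc_subset_uIcc ht⟩
  · simp
  · refine .of_forall fun t _ z hz => ?_
    have hzt : (z + t).im < 0 := by simpa using hball hz
    exact ((hF.differentiableAt (hopen.mem_nhds hzt)).hasDerivAt.comp_add_const z t).mul_const _

theorem continuousOn_intervalIntegral_comp_add {F : ℂ → ℂ}
    (hF : ContinuousOn F {z : ℂ | z.im ≤ 0}) {h : ℝ → ℂ} (hh : Continuous h) (a b : ℝ) :
    ContinuousOn (fun z => ∫ t in a..b, F (z + t) * h t) {z : ℂ | z.im ≤ 0} := by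
  rw [continuousOn_iff_continuous_domRestrict]
  refine intervalIntegral.continuous_parametric_intervalIntegral_of_continuous' ?_ a b
  refine (hF.comp_continuous (f := fun p : {z : ℂ | z.im ≤ 0} × ℝ => (p.1 : ℂ) + p.2)
    (by fun_prop) fun p => ?_).mul (by fun_prop)
  have := p.1.2
  rw [Set.mem_ofPred_eq] at this ⊢
  simpa using this

theorem ContinuousOn.continuous_horizontal {F : ℂ → ℂ} (hF : ContinuousOn F {z : ℂ | z.im ≤ 0})
    {y : ℝ} (hy : y ≤ 0) : Continuous fun x : ℝ => F (x + y * Complex.I) :=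
  hF.comp_continuous (by fun_prop) fun x => by simpa using hy

theorem norm_intervalIntegral_comp_add_le {F : ℂ → ℂ} (hF : ContinuousOn F {z : ℂ | z.im ≤ 0})
    {h : ℝ → ℂ} (hh : Continuous h) {a b : ℝ} (hab : a ≤ b) {z : ℂ} (hz : z.im ≤ 0)
    (hint : Integrable fun x : ℝ => ‖F (x + z.im * Complex.I)‖ ^ 2) :
    ‖∫ t in a..b, F (z + t) * h t‖ ≤
      ((∫ x : ℝ, ‖F (x + z.im * Complex.I)‖ ^ 2) + ∫ t in a..b, ‖h t‖ ^ 2) / 2 := by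
  have hshift : ∀ t : ℝ, z + t = ((t + z.re : ℝ) : ℂ) + z.im * Complex.I := fun t => by
    apply Complex.ext <;> simp [add_comm]
  have hFz : Continuous fun t : ℝ => F (z + t) :=
    hF.comp_continuous (by fun_prop) fun t => by simpa using hz
  have hFz2 : Continuous fun t : ℝ => ‖F (z + t)‖ ^ 2 := hFz.norm.pow 2
  have hh2 : Continuous fun t => ‖h t‖ ^ 2 := hh.norm.pow 2
  have hsq : ∫ t in a..b, ‖F (z + t)‖ ^ 2 ≤ ∫ x : ℝ, ‖F (x + z.im * Complex.I)‖ ^ 2 := by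
    rw [← integral_add_right_eq_self _ z.re, intervalIntegral.integral_of_le hab]
    simp_rw [hshift]
    exact setIntegral_le_integral (hint.comp_add_right z.re) (.of_forall fun t => by positivity)
  calc ‖∫ t in a..b, F (z + t) * h t‖
      ≤ ∫ t in a..b, ‖F (z + t) * h t‖ := intervalIntegral.norm_integral_le_integral_norm hab
    _ ≤ ∫ t in a..b, (‖F (z + t)‖ ^ 2 + ‖h t‖ ^ 2) / 2 := by
        refine intervalIntegral.integral_mono_on hab
          ((hFz.mul hh).norm.intervalIntegrable _ _)
          (((hFz2.add hh2).div_const 2).intervalIntegrable _ _) fun t _ => ?_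
        rw [norm_mul]
        linarith [two_mul_le_add_sq ‖F (z + t)‖ ‖h t‖]
    _ = ((∫ t in a..b, ‖F (z + t)‖ ^ 2) + ∫ t in a..b, ‖h t‖ ^ 2) / 2 := by
        rw [intervalIntegral.integral_div, intervalIntegral.integral_add
          (hFz2.intervalIntegrable _ _) (hh2.intervalIntegrable _ _)]
    _ ≤ _ := by gcongr

/-- On horizontal lines in the lower half-plane, the `L²` norm of a function of Hardy class from
below is at most the `L²` norm of its boundary values. -/
theorem HardyBelow.integral_sq_le {F : ℂ → ℂ} (hF : HardyBelow 2 F)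
    (hbd : Integrable fun x : ℝ => ‖F x‖ ^ 2) {y : ℝ} (hy : y < 0) :
    ∫ x : ℝ, ‖F (x + y * Complex.I)‖ ^ 2 ≤ ∫ x : ℝ, ‖F x‖ ^ 2 := by
  obtain ⟨hd, hc, M, hM⟩ := hF
  simp only [Real.rpow_two] at hM
  refine le_of_tendsto (intervalIntegral_tendsto_integral (hM y hy).1 tendsto_neg_atTop_atBot
    tendsto_id) ?_
  filter_upwards [eventually_ge_atTop 0] with R hR
  rw [id]
  have hR' : -R ≤ R := by linarith
  set h : ℝ → ℂ := fun t => (starRingEnd ℂ) (F (t + y * Complex.I))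
  have hh : Continuous h := Complex.continuous_conj.comp (hc.continuous_horizontal hy.le)
  have hnorm : ∀ t, ‖h t‖ = ‖F (t + y * Complex.I)‖ := fun t => RCLike.norm_conj _
  set A := ∫ t in -R..R, ‖F (t + y * Complex.I)‖ ^ 2 with hA
  set C := ∫ x : ℝ, ‖F x‖ ^ 2
  set G : ℂ → ℂ := fun w => ∫ t in -R..R, F (-Complex.I * w + t) * h t with hG
  have hA' : ∫ t in -R..R, ‖h t‖ ^ 2 = A := by simp only [hnorm, hA]
  have him : ∀ w : ℂ, (-Complex.I * w).im = -w.re := fun w => by simp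
  have hinside : ∀ w : ℂ, 0 < w.re → ‖G w‖ ≤ (M + A) / 2 := fun w hw => by
    have hw' : (-Complex.I * w).im < 0 := by rw [him]; linarith
    have := norm_intervalIntegral_comp_add_le hc hh hR' hw'.le (hM _ hw').1
    rw [hA'] at this
    linarith [(hM _ hw').2]
  have hboundary : ∀ x : ℝ, ‖G (x * Complex.I)‖ ≤ (C + A) / 2 := fun x => by
    have hx : (-Complex.I * (x * Complex.I)).im = 0 := by simp
    have := norm_intervalIntegral_comp_add_le hc hh hR' hx.le (by simpa [hx] using hbd)
    simpa only [hx, hA', Complex.ofReal_zero, zero_mul, add_zero] using this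
  have hcl : DiffContOnCl ℂ G {w | 0 < w.re} := by
    refine ⟨(differentiableOn_intervalIntegral_comp_add hd hh (-R) R).comp (by fun_prop)
      fun w hw => ?_, ?_⟩
    · simpa using hw
    · rw [Complex.closure_setOfPred_lt_re]
      exact (continuousOn_intervalIntegral_comp_add hc hh (-R) R).comp (by fun_prop)
        fun w hw => by simpa using hw
  have hbound := PhragmenLindelof.right_half_plane_of_bounded_on_real
    (z := ((-y : ℝ) : ℂ)) hcl
    ⟨0, two_pos, 0, Asymptotics.IsBigO.of_bound ((M + A) / 2) <| by
      filter_upwards [mem_inf_of_right (mem_principal_self _)] with w hw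
      simpa using hinside w hw⟩
    ⟨(M + A) / 2, by
      rw [eventually_map]
      filter_upwards [eventually_gt_atTop 0] with x hx
      exact hinside x (by simpa using hx)⟩
    hboundary (by simpa using hy.le)
  have hval : G ((-y : ℝ) : ℂ) = (A : ℂ) := by
    rw [hG, hA, ← intervalIntegral.integral_ofReal]
    refine intervalIntegral.integral_congr fun t _ => ?_
    have : -Complex.I * ((-y : ℝ) : ℂ) + t = t + y * Complex.I := by push_cast; ring
    simp only [this, h, Complex.mul_conj, Complex.normSq_eq_norm_sq]
  rw [hval, Complex.norm_real] at hbound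
  linarith [le_abs_self A, Real.norm_eq_abs A]

theorem one_le_norm_one_add_mul_I_mul {ε : ℝ} (hε : 0 ≤ ε) {z : ℂ} (hz : z.im ≤ 0) :
    1 ≤ ‖1 + ε * (Complex.I * z)‖ := by
  refine le_trans ?_ (Complex.re_le_norm _)
  simp
  nlinarith

theorem mul_norm_le_norm_one_add_mul_I_mul {ε : ℝ} (hε : 0 ≤ ε) {z : ℂ} (hz : z.im ≤ 0) :
    ε * ‖z‖ ≤ ‖1 + ε * (Complex.I * z)‖ := by
  refine le_of_sq_le_sq ?_ (norm_nonneg _)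
  rw [mul_pow, ← Complex.normSq_eq_norm_sq, ← Complex.normSq_eq_norm_sq, Complex.normSq_apply,
    Complex.normSq_apply]
  simp
  nlinarith

/-- The multiplier `z / (1 + iεz)` is bounded by `ε⁻¹` on the lower half-plane. -/
theorem HardyBelow.mul_regularized_pow {f : ℂ → ℂ} (hf : HardyBelow 2 f) {ε : ℝ} (hε : 0 < ε)
    (n : ℕ) : HardyBelow 2 fun z => (z / (1 + ε * (Complex.I * z))) ^ n * f z := by
  obtain ⟨hd, hc, M, hM⟩ := hf
  have hne : ∀ z : ℂ, z.im ≤ 0 → 1 + ε * (Complex.I * z) ≠ 0 := fun z hz =>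
    norm_pos_iff.mp (one_pos.trans_le (one_le_norm_one_add_mul_I_mul hε.le hz))
  have hcont : ContinuousOn (fun z => (z / (1 + ε * (Complex.I * z))) ^ n * f z)
      {z : ℂ | z.im ≤ 0} :=
    ((continuousOn_id.div (by fun_prop) hne).pow n).mul hc
  refine ⟨DifferentiableOn.mul (.pow (.div differentiableOn_id (by fun_prop)
    fun z hz => hne z (le_of_lt hz)) n) hd, hcont, (ε⁻¹ ^ n) ^ 2 * M, fun y hy => ?_⟩
  simp only [Real.rpow_two] at hM ⊢
  have hle : ∀ x : ℝ, ‖((x + y * Complex.I) / (1 + ε * (Complex.I * (x + y * Complex.I)))) ^ n *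
      f (x + y * Complex.I)‖ ^ 2 ≤ (ε⁻¹ ^ n) ^ 2 * ‖f (x + y * Complex.I)‖ ^ 2 := fun x => by
    have him : ((x : ℂ) + y * Complex.I).im ≤ 0 := by simpa using hy.le
    rw [norm_mul, norm_pow, norm_div, mul_pow]
    gcongr
    rw [div_le_iff₀ (norm_pos_iff.mpr (hne _ him)), inv_mul_eq_div, le_div_iff₀' hε]
    exact mul_norm_le_norm_one_add_mul_I_mul hε.le him
  have hint := (hM y hy).1.const_mul ((ε⁻¹ ^ n) ^ 2)
  have hint' := hint.mono' ((hcont.continuous_horizontal hy.le).norm.pow 2).aestronglyMeasurable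
    (.of_forall fun x => (Real.norm_of_nonneg (sq_nonneg _)).trans_le (hle x))
  refine ⟨hint', (integral_mono hint' hint hle).trans ?_⟩
  rw [integral_const_mul]
  gcongr
  exact (hM y hy).2

theorem SchwartzMap.integrable_sq_norm_pow_mul (φ : SchwartzMap ℝ ℂ) (n : ℕ) :
    Integrable fun x : ℝ => ‖(x : ℂ) ^ n * φ x‖ ^ 2 := by
  obtain ⟨C, -, hC⟩ := φ.decay n 0
  refine ((φ.integrable_pow_mul volume n).const_mul C).mono'
    (Continuous.aestronglyMeasurable (by fun_prop)) (.of_forall fun x => ?_)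
  have hx := hC x
  rw [norm_iteratedFDeriv_zero] at hx
  rw [Real.norm_of_nonneg (by positivity), norm_mul, norm_pow, Complex.norm_real, sq]
  gcongr

/-- Quantitative form: the weighted integrals are bounded by that of the boundary values. -/
theorem HardyBelow.lintegral_pow_mul_sq_le {f : ℂ → ℂ} (hf : HardyBelow 2 f) (n : ℕ)
    (hbd : Integrable fun x : ℝ => ‖(x : ℂ) ^ n * f x‖ ^ 2) {y : ℝ} (hy : y < 0) :
    ∫⁻ x : ℝ, ENNReal.ofReal (‖(x + y * Complex.I) ^ n * f (x + y * Complex.I)‖ ^ 2) ≤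
      ENNReal.ofReal (∫ x : ℝ, ‖(x : ℂ) ^ n * f x‖ ^ 2) := by
  set ε : ℕ → ℝ := fun k => 1 / (k + 1)
  have hε : ∀ k, 0 < ε k := fun k => Nat.one_div_pos_of_nat
  set F : ℕ → ℂ → ℂ := fun k z => (z / (1 + ε k * (Complex.I * z))) ^ n * f z with hFdef
  have hF : ∀ k, HardyBelow 2 (F k) := fun k => hf.mul_regularized_pow (hε k) n
  have hle : ∀ k (x : ℝ), ‖F k x‖ ^ 2 ≤ ‖(x : ℂ) ^ n * f x‖ ^ 2 := fun k x => by
    simp only [hFdef, norm_mul, norm_pow, norm_div]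
    gcongr
    exact div_le_self (norm_nonneg _) (one_le_norm_one_add_mul_I_mul (hε k).le (by simp))
  have hFint : ∀ k, Integrable fun x : ℝ => ‖F k x‖ ^ 2 := fun k => by
    have : Continuous fun x : ℝ => F k x := by
      simpa using (hF k).2.1.continuous_horizontal le_rfl
    exact hbd.mono' (this.norm.pow 2).aestronglyMeasurable
      (.of_forall fun x => by rw [Real.norm_of_nonneg (by positivity)]; exact hle k x)
  have hbound : ∀ k, ∫⁻ x : ℝ, ENNReal.ofReal (‖F k (x + y * Complex.I)‖ ^ 2) ≤
      ENNReal.ofReal (∫ x : ℝ, ‖(x : ℂ) ^ n * f x‖ ^ 2) := fun k => by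
    obtain ⟨_, _, M, hM⟩ := hF k
    rw [← ofReal_integral_eq_lintegral_ofReal (by simpa using (hM y hy).1)
      (.of_forall fun x => by positivity)]
    exact ENNReal.ofReal_le_ofReal (((hF k).integral_sq_le (hFint k) hy).trans
      (integral_mono (hFint k) hbd (hle k)))
  have hlim : ∀ z : ℂ, Tendsto (fun k => F k z) atTop (nhds (z ^ n * f z)) := fun z => by
    have h0 : Tendsto (fun k => (ε k : ℂ)) atTop (nhds ((0 : ℝ) : ℂ)) :=
      (Complex.continuous_ofReal.tendsto 0).comp tendsto_one_div_add_atTop_nhds_zero_nat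
    have h1 : Tendsto (fun k => 1 + (ε k : ℂ) * (Complex.I * z)) atTop (nhds 1) := by
      simpa using (h0.mul_const (Complex.I * z)).const_add 1
    simpa using (((tendsto_const_nhds (x := z)).div h1 one_ne_zero).pow n).mul_const (f z)
  calc _ = ∫⁻ x : ℝ, liminf
        (fun k => ENNReal.ofReal (‖F k (x + y * Complex.I)‖ ^ 2)) atTop := by
        refine lintegral_congr fun x => (Tendsto.liminf_eq ?_).symm
        exact (ENNReal.continuous_ofReal.tendsto _).comp ((hlim _).norm.pow 2)
    _ ≤ liminf (fun k => ∫⁻ x : ℝ, ENNReal.ofReal (‖F k (x + y * Complex.I)‖ ^ 2)) atTop :=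
        lintegral_liminf_le fun k =>
          (((hF k).2.1.continuous_horizontal hy.le).norm.pow 2).measurable.ennreal_ofReal
    _ ≤ _ := liminf_le_of_frequently_le' (.of_forall hbound)

/-- If `f` is Hardy class from below of order 2 with Schwartz boundary values, then
for every `n` the weighted horizontal integrals `∫ |x+iy|^n |f(x+iy)|² dx` are
uniformly bounded for `y < 0`. -/
theorem hardyBelow_schwartz_power_weight_bound (f : ℂ → ℂ) (hf : HardyBelow 2 f)
    (hfS : ∃ φ : SchwartzMap ℝ ℂ, ∀ x : ℝ, f ↑x = φ x) (n : ℕ) :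
    ∃ M : ℝ, ∀ y : ℝ, y < 0 →
      Integrable (fun x : ℝ =>
        ‖(↑x + ↑y * Complex.I : ℂ)‖ ^ n * ‖f (↑x + ↑y * Complex.I)‖ ^ 2) ∧
      ∫ x : ℝ, ‖(↑x + ↑y * Complex.I : ℂ)‖ ^ n * ‖f (↑x + ↑y * Complex.I)‖ ^ 2 ≤ M := by
  obtain ⟨φ, hφ⟩ := hfS
  have hbd : Integrable fun x : ℝ => ‖(x : ℂ) ^ n * f x‖ ^ 2 := by
    simpa only [hφ] using φ.integrable_sq_norm_pow_mul n
  have hc := hf.2.1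
  have hle := fun {y : ℝ} (hy : y < 0) => hf.lintegral_pow_mul_sq_le n hbd hy
  obtain ⟨M, hM⟩ := hf.2.2
  simp only [Real.rpow_two] at hM
  refine ⟨M + ∫ x : ℝ, ‖(x : ℂ) ^ n * f x‖ ^ 2, fun y hy => ?_⟩
  have hfy := hc.continuous_horizontal hy.le
  have hline : Continuous fun x : ℝ => (x + y * Complex.I : ℂ) := by fun_prop
  have hint : Integrable fun x : ℝ => ‖(x + y * Complex.I) ^ n * f (x + y * Complex.I)‖ ^ 2 := by
    refine ⟨((hline.pow n).mul hfy).norm.pow 2 |>.aestronglyMeasurable, ?_⟩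
    rw [hasFiniteIntegral_iff_ofReal (.of_forall fun x => by positivity)]
    exact (hle hy).trans_lt ENNReal.ofReal_lt_top
  have hI : ∫ x : ℝ, ‖(x + y * Complex.I) ^ n * f (x + y * Complex.I)‖ ^ 2 ≤
      ∫ x : ℝ, ‖(x : ℂ) ^ n * f x‖ ^ 2 := by
    rw [← ENNReal.ofReal_le_ofReal_iff (integral_nonneg fun x => by positivity),
      ofReal_integral_eq_lintegral_ofReal hint (.of_forall fun x => by positivity)]
    exact hle hy
  have hpt : ∀ x : ℝ, ‖(x + y * Complex.I : ℂ)‖ ^ n * ‖f (x + y * Complex.I)‖ ^ 2 ≤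
      ‖f (x + y * Complex.I)‖ ^ 2 + ‖(x + y * Complex.I) ^ n * f (x + y * Complex.I)‖ ^ 2 := by
    intro x
    rw [norm_mul, norm_pow, mul_pow, ← one_add_mul]
    gcongr
    nlinarith [sq_nonneg (‖(x + y * Complex.I : ℂ)‖ ^ n - 1)]
  have hsum := (hM y hy).1.add hint
  have hint' : Integrable fun x : ℝ =>
      ‖(x + y * Complex.I : ℂ)‖ ^ n * ‖f (x + y * Complex.I)‖ ^ 2 :=
    hsum.mono' (((hline.norm.pow n).mul (hfy.norm.pow 2)).aestronglyMeasurable) (.of_forall fun x => by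
      rw [Real.norm_of_nonneg (by positivity)]; exact hpt x)
  refine ⟨hint', (integral_mono hint' hsum hpt).trans ?_⟩
  simp only [Pi.add_apply]
  rw [integral_add (hM y hy).1 hint]
  exact add_le_add (hM y hy).2 hI
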